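/- Let λ > 1 and μ > 0. There exists ν₀ > μϱ(λ) such that for every ν ≥ ν₀ and every maximizer ω ∈ Σ_{μ,ν,λ}, the constants W, γ in the Euler–Lagrange relation ω = λ(𝒢ω − W x₂ − γ)₊ satisfy W > 0 and γ = 0; that is, ω = λ(𝒢ω − W x₂)₊ almost everywhere in Π for some W > 0. -/

import Mathlib

open MeasureTheory Real Filter

noncomputable section

/-- The upper half plane `Π = {x ∈ ℝ² : x₂ > 0}`. -/
def UHP : Set (ℝ × ℝ) := {x | 0 < x.2}

/-- Euclidean norm of a point of `ℝ²`. -/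
def rad (x : ℝ × ℝ) : ℝ := Real.sqrt (x.1 ^ 2 + x.2 ^ 2)

/-- Modified Bessel function of the second kind of order `0`:
`K₀(r) = ∫₀^∞ exp(-r cosh t) dt`. -/
def K0 (r : ℝ) : ℝ := ∫ t in Set.Ioi (0 : ℝ), Real.exp (-(r * Real.cosh t))

/-- Fundamental solution `G(x,y) = (1/2π) K₀(|x-y|)` of `−Δ + Id` on `ℝ²`. -/
def Gker (x y : ℝ × ℝ) : ℝ := (1 / (2 * Real.pi)) * K0 (rad (x - y))

/-- Reflection `x̄ = (x₁, −x₂)` across the `x₁`-axis. -/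
def reflPt (x : ℝ × ℝ) : ℝ × ℝ := (x.1, -x.2)

/-- Green's function `G_Π(x,y) = G(x,y) − G(x̄,y)` of `−Δ + Id` on the half plane. -/
def GUHP (x y : ℝ × ℝ) : ℝ := Gker x y - Gker (reflPt x) y

/-- The operator `𝒢ω(x) = ∫_Π G_Π(x,y) ω(y) dy`. -/
def Gop (ω : ℝ × ℝ → ℝ) (x : ℝ × ℝ) : ℝ := ∫ y in UHP, GUHP x y * ω y

/-- Kinetic energy `E(ω) = (1/2) ∫_Π ω 𝒢ω`. -/
def kineticE (ω : ℝ × ℝ → ℝ) : ℝ := (1 / 2) * ∫ x in UHP, ω x * Gop ω x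

/-- Impulse `I(ω) = ∫_Π x₂ ω dx`. -/
def impulse (ω : ℝ × ℝ → ℝ) : ℝ := ∫ x in UHP, x.2 * ω x

/-- `L¹(Π)` norm. -/
def normL1 (f : ℝ × ℝ → ℝ) : ℝ := ∫ x in UHP, |f x|

/-- `L²(Π)` norm. -/
def normL2 (f : ℝ × ℝ → ℝ) : ℝ := (∫ x in UHP, (f x) ^ 2) ^ ((1 : ℝ) / 2)

/-- `L^s(Π)` norm. -/
def normLs (s : ℝ) (f : ℝ × ℝ → ℝ) : ℝ := (∫ x in UHP, |f x| ^ s) ^ (1 / s)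

/-- Nonnegative member of `L¹(Π) ∩ L²(Π)`. -/
def NonnegL1L2 (ω : ℝ × ℝ → ℝ) : Prop :=
  (∀ x ∈ UHP, 0 ≤ ω x) ∧ IntegrableOn ω UHP ∧ IntegrableOn (fun x => (ω x) ^ 2) UHP

/-- Steiner symmetry in the `x₁` variable. -/
def SteinerSym (f : ℝ × ℝ → ℝ) : Prop :=
  (∀ x : ℝ × ℝ, f (-x.1, x.2) = f x) ∧
  ∀ x₂ : ℝ, 0 < x₂ → AntitoneOn (fun x₁ => f (x₁, x₂)) (Set.Ioi (0 : ℝ))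

/-- The admissible class `𝒜_{μ,ν}`. -/
def InAdm (μ ν : ℝ) (ω : ℝ × ℝ → ℝ) : Prop :=
  (∀ x ∈ UHP, 0 ≤ ω x) ∧ IntegrableOn ω UHP ∧ IntegrableOn (fun x => (ω x) ^ 2) UHP ∧
  IntegrableOn (fun x => x.2 * ω x) UHP ∧
  impulse ω = μ ∧ (∫ x in UHP, ω x) ≤ ν

/-- The energy functional `ℰ_λ(ω) = E(ω) − (1/(2λ)) ∫_Π ω²`. -/
def Efun (lam : ℝ) (ω : ℝ × ℝ → ℝ) : ℝ :=
  kineticE ω - (1 / (2 * lam)) * ∫ x in UHP, (ω x) ^ 2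

/-- The supremum `S_{μ,ν,λ} = sup_{ω ∈ 𝒜_{μ,ν}} ℰ_λ(ω)`. -/
def Sval (lam μ ν : ℝ) : ℝ := sSup {s | ∃ ω, InAdm μ ν ω ∧ s = Efun lam ω}

/-- `ω` is a maximizer, i.e. `ω ∈ Σ_{μ,ν,λ}`. -/
def IsMaximizer (lam μ ν : ℝ) (ω : ℝ × ℝ → ℝ) : Prop :=
  InAdm μ ν ω ∧ Efun lam ω = Sval lam μ ν

/-- Bessel function of the first kind of order one. -/
def J1 (r : ℝ) : ℝ :=
  ∑' k : ℕ, ((-1 : ℝ) ^ k / ((Nat.factorial k : ℝ) * (Nat.factorial (k + 1) : ℝ))) *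
    (r / 2) ^ (2 * k + 1)

/-- Modified Bessel function of the second kind of order one. -/
def K1 (r : ℝ) : ℝ := ∫ t in Set.Ioi (0 : ℝ), Real.exp (-(r * Real.cosh t)) * Real.cosh t

/-- The set of `t > 0` with `J₁(√(λ−1) t) ≠ 0` solving the transcendental equation
`t (K₁'(t)/K₁(t) + (λ−1)^{-1/2} J₁'(√(λ−1)t)/J₁(√(λ−1)t)) = λ/(λ−1)`. -/
def aSet (lam : ℝ) : Set ℝ :=
  {t | 0 < t ∧ J1 (Real.sqrt (lam - 1) * t) ≠ 0 ∧
    t * (deriv K1 t / K1 t +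
      (1 / Real.sqrt (lam - 1)) *
        (deriv J1 (Real.sqrt (lam - 1) * t) / J1 (Real.sqrt (lam - 1) * t))) = lam / (lam - 1)}

/-- The smallest positive solution `a = a(λ)`. -/
def aLam (lam : ℝ) : ℝ := sInf (aSet lam)

/-- The stream function `Ψ_L^{λ,W}` of the Lamb dipole, written in polar coordinates
`x₁ = r cos θ`, `x₂ = r sin θ` (so that `sin θ = x₂ / r`). -/
def PsiL (lam W : ℝ) (x : ℝ × ℝ) : ℝ :=
  if rad x ≤ aLam lam then
    ((-(W * aLam lam / (lam - 1)) / J1 (Real.sqrt (lam - 1) * aLam lam)) *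
        J1 (Real.sqrt (lam - 1) * rad x) + (W * lam / (lam - 1)) * rad x) * (x.2 / rad x)
  else (W * aLam lam / K1 (aLam lam)) * K1 (rad x) * (x.2 / rad x)

/-- The Lamb dipole `ω_L^{λ,W} = λ (Ψ_L^{λ,W} − W x₂)₊` restricted to `Π`. -/
def omegaL (lam W : ℝ) (x : ℝ × ℝ) : ℝ :=
  if 0 < x.2 then lam * max (PsiL lam W x - W * x.2) 0 else 0

/-- `ϱ(λ) = (∫_Π ω_L^{λ,1} dx) / I(ω_L^{λ,1})`. -/
def varrho (lam : ℝ) : ℝ := (∫ x in UHP, omegaL lam 1 x) / impulse (omegaL lam 1)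

/-- The Laplacian on `ℝ²`, written coordinatewise. -/
def lap (ψ : ℝ × ℝ → ℝ) (x : ℝ × ℝ) : ℝ :=
  deriv (deriv fun t => ψ (t, x.2)) x.1 + deriv (deriv fun t => ψ (x.1, t)) x.2

/-- Distance (in `L¹ ∩ L²` plus weighted `L¹`) from `ζ` to a set of functions `S`. -/
def distToSet (S : Set ((ℝ × ℝ) → ℝ)) (ζ : (ℝ × ℝ) → ℝ) : ℝ :=
  sInf {d | ∃ ω ∈ S, d = normL1 (fun x => ζ x - ω x) + normL2 (fun x => ζ x - ω x) +
    normL1 (fun x => x.2 * (ζ x - ω x))}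

end

/-! ### Properties of `K0` -/

lemma k0_integrable {r : ℝ} (hr : 0 < r) :
    IntegrableOn (fun t => Real.exp (-(r * Real.cosh t))) (Set.Ioi 0) := by
  have h := exp_neg_integrableOn_Ioi 0 hr
  refine Integrable.mono' h (by fun_prop) ?_
  refine (ae_restrict_iff' measurableSet_Ioi).2 (Eventually.of_forall fun t ht => ?_)
  have ht : 0 < t := ht
  rw [Real.norm_eq_abs, abs_of_pos (Real.exp_pos _)]
  apply Real.exp_le_exp.2
  have h1 : t ≤ Real.cosh t := by
    have := Real.cosh_eq t
    have h2 := Real.add_one_le_exp t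
    have h3 := Real.quadratic_le_exp_of_nonneg ht.le
    have h4 := Real.exp_pos (-t)
    nlinarith [sq_nonneg (t - 1)]
  nlinarith

lemma k0_nonneg (r : ℝ) : 0 ≤ K0 r :=
  integral_nonneg fun _ => (Real.exp_pos _).le

lemma k0_anti {r s : ℝ} (hr : 0 < r) (hrs : r ≤ s) : K0 s ≤ K0 r := by
  refine integral_mono (k0_integrable (hr.trans_le hrs)) (k0_integrable hr) fun t => ?_
  apply Real.exp_le_exp.2
  have := Real.cosh_pos t
  nlinarith

lemma k0_measurable : Measurable K0 := by
  have : StronglyMeasurable K0 := by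
    apply StronglyMeasurable.integral_prod_right
      (f := fun (r t : ℝ) => Real.exp (-(r * Real.cosh t)))
    apply Continuous.stronglyMeasurable
    fun_prop
  exact this.measurable

lemma k0_ofReal {r : ℝ} (hr : 0 < r) :
    ENNReal.ofReal (K0 r) =
      ∫⁻ t in Set.Ioi (0 : ℝ), ENNReal.ofReal (Real.exp (-(r * Real.cosh t))) :=
  ofReal_integral_eq_lintegral_ofReal (k0_integrable hr)
    (Eventually.of_forall fun _ => (Real.exp_pos _).le)

lemma rexp_lintegral {c : ℝ} (hc : 0 < c) :
    ∫⁻ r in Set.Ioi (0 : ℝ), ENNReal.ofReal r * ENNReal.ofReal (Real.exp (-(r * c)))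
      = ENNReal.ofReal (1 / c ^ 2) := by
  have h := Real.integral_rpow_mul_exp_neg_mul_Ioi (a := 2) (r := c) (by norm_num) hc
  have e : ∀ t : ℝ, t ^ ((2 : ℝ) - 1) * Real.exp (-(c * t)) = t * Real.exp (-(t * c)) := by
    intro t
    rw [show (2 : ℝ) - 1 = 1 by norm_num, Real.rpow_one, mul_comm c t]
  have e2 : (1 / c) ^ (2 : ℝ) * Real.Gamma 2 = 1 / c ^ 2 := by
    rw [Real.Gamma_two, mul_one, Real.rpow_two]
    field_simp
  simp_rw [e] at h
  rw [e2] at h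
  have hi : Integrable (fun t : ℝ => t * Real.exp (-(t * c))) (volume.restrict (Set.Ioi 0)) := by
    apply Integrable.of_integral_ne_zero
    rw [h]
    positivity
  rw [← h, ofReal_integral_eq_lintegral_ofReal hi]
  · refine setLIntegral_congr_fun measurableSet_Ioi fun t ht => ?_
    exact (ENNReal.ofReal_mul (le_of_lt ht)).symm
  · refine (ae_restrict_iff' measurableSet_Ioi).2 (Eventually.of_forall fun t ht => ?_)
    have ht : 0 < t := ht
    simp only [Pi.zero_apply]
    positivity

lemma rad_polar {p : ℝ × ℝ} (hp : 0 < p.1) : rad (polarCoord.symm p) = p.1 := by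
  rw [polarCoord_symm_apply, rad]
  have : (p.1 * Real.cos p.2) ^ 2 + (p.1 * Real.sin p.2) ^ 2 = p.1 ^ 2 := by
    nlinarith [Real.sin_sq_add_cos_sq p.2]
  simp only [this]
  exact Real.sqrt_sq hp.le

lemma exp_rad_lintegral {c : ℝ} (hc : 0 < c) :
    ∫⁻ z : ℝ × ℝ, ENNReal.ofReal (Real.exp (-(rad z * c)))
      = ENNReal.ofReal (2 * π) * ENNReal.ofReal (1 / c ^ 2) := by
  rw [← lintegral_comp_polarCoord_symm]
  have : ∫⁻ (p : ℝ × ℝ) in polarCoord.target,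
      ENNReal.ofReal p.1 • ENNReal.ofReal (Real.exp (-(rad (polarCoord.symm p) * c)))
      = ∫⁻ (p : ℝ × ℝ) in (Set.Ioi (0:ℝ)) ×ˢ (Set.Ioo (-π) π),
        (ENNReal.ofReal p.1 * ENNReal.ofReal (Real.exp (-(p.1 * c)))) * 1 := by
    refine setLIntegral_congr_fun polarCoord.open_target.measurableSet fun p hp => ?_
    have hp1 : 0 < p.1 := hp.1
    simp only [rad_polar hp1, smul_eq_mul, mul_one]
  rw [this, Measure.volume_eq_prod, ← Measure.prod_restrict,
    lintegral_prod_mul (f := fun r : ℝ => ENNReal.ofReal r * ENNReal.ofReal (Real.exp (-(r * c))))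
      (g := fun _ => 1) (by fun_prop) (by fun_prop), rexp_lintegral hc]
  simp only [lintegral_const, one_mul, Measure.restrict_apply MeasurableSet.univ, Set.univ_inter,
    Real.volume_Ioo]
  rw [mul_comm]
  congr 2
  ring

lemma tanh_tendsto : Tendsto Real.tanh atTop (nhds 1) := by
  have h : ∀ x : ℝ, Real.tanh x = (1 - Real.exp (-x) ^ 2) / (1 + Real.exp (-x) ^ 2) := by
    intro x
    rw [Real.tanh_eq_sinh_div_cosh, Real.sinh_eq, Real.cosh_eq, Real.exp_neg]
    have := Real.exp_pos x
    field_simp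
  have h2 : Tendsto (fun x : ℝ => Real.exp (-x)) atTop (nhds 0) :=
    Real.tendsto_exp_neg_atTop_nhds_zero
  rw [show Real.tanh = _ from funext h]
  have := ((h2.pow 2).const_sub 1).div ((h2.pow 2).const_add 1) (by norm_num)
  simp only [ne_eq, OfNat.ofNat_ne_zero, not_false_eq_true, zero_pow, sub_zero, add_zero,
    div_one] at this
  exact this

lemma sech_lintegral :
    ∫⁻ t in Set.Ioi (0 : ℝ), ENNReal.ofReal (1 / Real.cosh t ^ 2) = 1 := by
  have hd : ∀ x ∈ Set.Ici (0:ℝ), HasDerivAt Real.tanh (1 / Real.cosh x ^ 2) x := by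
    intro x _
    have h := (Real.hasDerivAt_sinh x).div (Real.hasDerivAt_cosh x) (Real.cosh_pos x).ne'
    have e : (Real.sinh / Real.cosh : ℝ → ℝ) = Real.tanh := by
      ext y
      simp [Real.tanh_eq_sinh_div_cosh]
    rw [e] at h
    rw [← Real.cosh_sq_sub_sinh_sq x]
    rw [← pow_two, ← pow_two] at h
    exact h
  have hp : ∀ x ∈ Set.Ioi (0:ℝ), 0 ≤ 1 / Real.cosh x ^ 2 := fun x _ => by positivity
  have h1 := integral_Ioi_of_hasDerivAt_of_nonneg' hd hp tanh_tendsto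
  have h2 := integrableOn_Ioi_deriv_of_nonneg' hd hp tanh_tendsto
  rw [← ofReal_integral_eq_lintegral_ofReal h2 (Eventually.of_forall fun x => by
    simp only [Pi.zero_apply]; positivity), h1]
  simp

/-! ### The kernel `gk` -/

/-- The translation-invariant kernel. -/
noncomputable def gk (z : ℝ × ℝ) : ℝ := (1 / (2 * Real.pi)) * K0 (rad z)

lemma rad_cont : Continuous rad := by unfold rad; fun_prop

lemma gk_nonneg (z : ℝ × ℝ) : 0 ≤ gk z := mul_nonneg (by positivity) (k0_nonneg _)

lemma gk_measurable : Measurable gk :=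
  (k0_measurable.comp rad_cont.measurable).const_mul _

lemma rad_pos {z : ℝ × ℝ} (hz : z ≠ 0) : 0 < rad z := by
  apply Real.sqrt_pos.2
  by_contra h
  apply hz
  ext
  · simp only [Prod.fst_zero]; nlinarith [sq_nonneg z.1, sq_nonneg z.2]
  · simp only [Prod.snd_zero]; nlinarith [sq_nonneg z.1, sq_nonneg z.2]

lemma gk_lintegral : ∫⁻ z, ENNReal.ofReal (gk z) = 1 := by
  have hae : ∀ᵐ z : ℝ × ℝ, z ≠ 0 := by
    simp [ae_iff]
  have h1 : ∫⁻ z, ENNReal.ofReal (gk z) = ∫⁻ z : ℝ × ℝ, ENNReal.ofReal (1 / (2 * π)) *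
      ∫⁻ t in Set.Ioi (0 : ℝ), ENNReal.ofReal (Real.exp (-(rad z * Real.cosh t))) := by
    refine lintegral_congr_ae ?_
    filter_upwards [hae] with z hz
    rw [← k0_ofReal (rad_pos hz), gk, ENNReal.ofReal_mul (by positivity)]
  have hm : Measurable (fun p : (ℝ × ℝ) × ℝ =>
      ENNReal.ofReal (Real.exp (-(rad p.1 * Real.cosh p.2)))) := by
    apply Measurable.ennreal_ofReal
    apply Continuous.measurable
    have := rad_cont
    fun_prop
  rw [h1, lintegral_const_mul _ (hm.lintegral_prod_right'), lintegral_lintegral_swap hm.aemeasurable]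
  simp_rw [exp_rad_lintegral (Real.cosh_pos _)]
  rw [lintegral_const_mul _ (by fun_prop), sech_lintegral, mul_one,
    ← ENNReal.ofReal_mul (by positivity)]
  rw [show 1 / (2 * π) * (2 * π) = 1 by field_simp]
  simp

lemma gk_integrable : Integrable gk := by
  refine ⟨gk_measurable.aestronglyMeasurable, ?_⟩
  rw [hasFiniteIntegral_iff_ofReal (Eventually.of_forall gk_nonneg), gk_lintegral]
  simp

lemma gk_integral : ∫ z, gk z = 1 := by
  rw [integral_eq_lintegral_of_nonneg_ae (Eventually.of_forall gk_nonneg)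
    gk_measurable.aestronglyMeasurable, gk_lintegral]
  simp

lemma rad_smul_half (z : ℝ × ℝ) : rad ((1/2 : ℝ) • z) = rad z / 2 := by
  unfold rad
  rw [Prod.smul_fst, Prod.smul_snd, smul_eq_mul, smul_eq_mul,
    show (1/2 * z.1) ^ 2 + (1/2 * z.2) ^ 2 = (z.1 ^ 2 + z.2 ^ 2) / 2 ^ 2 by ring,
    Real.sqrt_div' _ (by positivity), Real.sqrt_sq (by norm_num)]

lemma k0_mul_le {r : ℝ} (hr : 0 < r) : r * K0 r ≤ 2 * K0 (r / 2) := by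
  unfold K0
  rw [← integral_const_mul, ← integral_const_mul]
  refine integral_mono ((k0_integrable hr).const_mul _)
    ((k0_integrable (half_pos hr)).const_mul _) fun t => ?_
  have hc := Real.one_le_cosh t
  have e : Real.exp (-(r * Real.cosh t)) =
      Real.exp (-(r / 2 * Real.cosh t)) * Real.exp (-(r / 2 * Real.cosh t)) := by
    rw [← Real.exp_add]; congr 1; ring
  simp only
  have h1 : r / 2 ≤ Real.exp (r / 2 * Real.cosh t) := by
    have := Real.add_one_le_exp (r / 2 * Real.cosh t)
    nlinarith
  have h2 : r / 2 * Real.exp (-(r / 2 * Real.cosh t)) ≤ 1 := by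
    rw [Real.exp_neg, ← div_eq_mul_inv, div_le_one (Real.exp_pos _)]
    exact h1
  rw [e]
  have := Real.exp_pos (-(r / 2 * Real.cosh t))
  nlinarith

lemma abs_snd_le_rad (z : ℝ × ℝ) : |z.2| ≤ rad z := by
  apply Real.le_sqrt_of_sq_le
  rw [sq_abs]; nlinarith [sq_nonneg z.1]

lemma abs_fst_le_rad (z : ℝ × ℝ) : |z.1| ≤ rad z := by
  apply Real.le_sqrt_of_sq_le
  rw [sq_abs]; nlinarith [sq_nonneg z.2]

lemma snd_gk_integrable : Integrable (fun z : ℝ × ℝ => z.2 * gk z) := by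
  have h := (gk_integrable.comp_smul (R := (1/2 : ℝ)) (by norm_num)).const_mul 2
  refine Integrable.mono' h (measurable_snd.mul gk_measurable).aestronglyMeasurable
    (Eventually.of_forall fun z => ?_)
  rw [Real.norm_eq_abs, abs_mul, abs_of_nonneg (gk_nonneg z)]
  by_cases hz : z = 0
  · subst hz
    simpa using gk_nonneg _
  · have h1 := k0_mul_le (rad_pos hz)
    calc |z.2| * gk z ≤ rad z * gk z :=
          mul_le_mul_of_nonneg_right (abs_snd_le_rad z) (gk_nonneg z)
      _ = 1 / (2 * π) * (rad z * K0 (rad z)) := by unfold gk; ring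
      _ ≤ 1 / (2 * π) * (2 * K0 (rad z / 2)) := by gcongr
      _ = 2 * gk ((1/2 : ℝ) • z) := by rw [gk, rad_smul_half]; ring

lemma k0_integrableOn : IntegrableOn K0 (Set.Ioi 0) := by
  refine ⟨k0_measurable.aestronglyMeasurable, ?_⟩
  rw [hasFiniteIntegral_iff_ofReal (Eventually.of_forall k0_nonneg)]
  have h1 : ∫⁻ r in Set.Ioi (0:ℝ), ENNReal.ofReal (K0 r) = ∫⁻ r in Set.Ioi (0:ℝ),
      ∫⁻ t in Set.Ioi (0 : ℝ), ENNReal.ofReal (Real.exp (-(r * Real.cosh t))) :=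
    setLIntegral_congr_fun measurableSet_Ioi fun r hr => k0_ofReal hr
  have hm : Measurable (fun p : ℝ × ℝ =>
      ENNReal.ofReal (Real.exp (-(p.1 * Real.cosh p.2)))) := by
    apply Measurable.ennreal_ofReal
    apply Continuous.measurable
    fun_prop
  rw [h1, lintegral_lintegral_swap hm.aemeasurable]
  have h2 : ∀ t : ℝ, ∫⁻ r in Set.Ioi (0:ℝ), ENNReal.ofReal (Real.exp (-(r * Real.cosh t)))
      ≤ ENNReal.ofReal (2 * Real.exp (-t)) := by
    intro t
    have hc := Real.cosh_pos t
    have hi := integrableOn_exp_mul_Ioi (a := -Real.cosh t) (by linarith) 0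
    have hv := integral_exp_mul_Ioi (a := -Real.cosh t) (by linarith) 0
    have e : ∀ r : ℝ, Real.exp (-(r * Real.cosh t)) = Real.exp (-Real.cosh t * r) := by
      intro r; congr 1; ring
    simp_rw [e]
    rw [← ofReal_integral_eq_lintegral_ofReal hi
      (Eventually.of_forall fun x => (Real.exp_pos _).le), hv]
    apply ENNReal.ofReal_le_ofReal
    simp only [mul_zero, Real.exp_zero]
    rw [neg_div_neg_eq, div_le_iff₀ hc, Real.cosh_eq]
    have : Real.exp (-t) * Real.exp t = 1 := by rw [← Real.exp_add]; simp
    nlinarith [Real.exp_pos (-t)]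
  refine lt_of_le_of_lt (lintegral_mono h2) ?_
  have hi : IntegrableOn (fun t : ℝ => 2 * Real.exp (-t)) (Set.Ioi 0) :=
    Integrable.const_mul (by simpa [IntegrableOn] using exp_neg_integrableOn_Ioi 0 one_pos) 2
  have := hi.2
  rwa [hasFiniteIntegral_iff_ofReal (Eventually.of_forall fun t => by positivity)] at this

lemma k0_abs_integrable : Integrable (fun x : ℝ => K0 |x|) := by
  have hf : IntegrableOn (fun x : ℝ => K0 |x|) (Set.Ioi 0) :=
    k0_integrableOn.congr_fun (fun x hx => by rw [abs_of_pos hx]) measurableSet_Ioi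
  have int_Iic : IntegrableOn (fun x : ℝ => K0 |x|) (Set.Iic 0) := by
    rw [← Measure.map_neg_eq_self (volume : Measure ℝ)]
    let m : MeasurableEmbedding fun x : ℝ => -x := (Homeomorph.neg ℝ).measurableEmbedding
    rw [m.integrableOn_map_iff]
    simp_rw [Function.comp_def, abs_neg, Set.neg_preimage, Set.neg_Iic, neg_zero]
    exact Iff.mpr integrableOn_Ici_iff_integrableOn_Ioi hf
  have := int_Iic.union hf
  rwa [Set.Iic_union_Ioi, integrableOn_univ] at this

/-- strip constant -/
noncomputable def stripC : ℝ := ∫ x : ℝ, K0 |x|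

lemma stripC_nonneg : 0 ≤ stripC := integral_nonneg fun _ => k0_nonneg _

lemma strip_bound {y : ℝ} (hy : 0 < y) :
    ∫ z : ℝ × ℝ, (Set.Icc (-y) y).indicator (fun _ => (1:ℝ)) z.2 * gk z ≤ stripC * y := by
  have h1 : Integrable (fun z : ℝ × ℝ => K0 |z.1| * (Set.Icc (-y) y).indicator (fun _ => (1:ℝ)) z.2) := by
    apply k0_abs_integrable.mul_prod
    rw [integrable_indicator_iff measurableSet_Icc]
    exact integrableOn_const (by simp)
  have hv : ∫ z : ℝ × ℝ, K0 |z.1| * (Set.Icc (-y) y).indicator (fun _ => (1:ℝ)) z.2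
      = stripC * (2 * y) := by
    rw [Measure.volume_eq_prod, integral_prod_mul (f := fun x : ℝ => K0 |x|), stripC,
      integral_indicator measurableSet_Icc]
    congr 1
    simp [hy.le]
    ring
  have hpi : 1 / (2 * π) ≤ 1 / 2 := by
    have := Real.pi_gt_three
    rw [div_le_div_iff₀ (by positivity) (by positivity)]
    linarith
  have hae : ∀ᵐ z : ℝ × ℝ, z.1 ≠ 0 := by
    have : ∀ᵐ x : ℝ, x ≠ 0 := by simp [ae_iff]
    exact Measure.quasiMeasurePreserving_fst.ae this
  calc _ ≤ ∫ z : ℝ × ℝ, (1/2) * (K0 |z.1| * (Set.Icc (-y) y).indicator (fun _ => (1:ℝ)) z.2) := by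
        refine integral_mono_of_nonneg (Eventually.of_forall fun z => ?_) (h1.const_mul _) ?_
        · exact mul_nonneg (Set.indicator_nonneg (fun _ _ => zero_le_one) _) (gk_nonneg z)
        · filter_upwards [hae] with z hz
          have h3 : gk z ≤ 1/2 * K0 |z.1| := by
            have := k0_anti (abs_pos.2 hz) (abs_fst_le_rad z)
            have h0 := k0_nonneg (rad z)
            unfold gk
            nlinarith
          have h4 : 0 ≤ (Set.Icc (-y) y).indicator (fun _ => (1:ℝ)) z.2 :=
            Set.indicator_nonneg (fun _ _ => zero_le_one) _
          nlinarith
    _ = _ := by rw [integral_const_mul, hv]; ring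

/-! ### The half-plane kernel -/

/-- Lebesgue measure on the half plane. -/
noncomputable abbrev mU : Measure (ℝ × ℝ) := volume.restrict UHP

lemma uhp_meas : MeasurableSet UHP := measurableSet_lt measurable_const measurable_snd

lemma mU_ae {p : ℝ × ℝ → Prop} (h : ∀ x ∈ UHP, p x) : ∀ᵐ x ∂mU, p x :=
  (ae_restrict_iff' uhp_meas).2 (Eventually.of_forall h)

lemma gk_neg (z : ℝ × ℝ) : gk (-z) = gk z := by
  simp [gk, rad]

lemma gk_sub_comm (x y : ℝ × ℝ) : gk (x - y) = gk (y - x) := by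
  rw [← gk_neg, neg_sub]

lemma guhp_eq (x y : ℝ × ℝ) : GUHP x y = gk (x - y) - gk (reflPt x - y) := rfl

lemma refl_meas : Measurable reflPt := by unfold reflPt; fun_prop

lemma guhp_meas : Measurable (fun p : (ℝ × ℝ) × (ℝ × ℝ) => GUHP p.1 p.2) := by
  simp_rw [guhp_eq]
  exact (gk_measurable.comp (measurable_fst.sub measurable_snd)).sub
    (gk_measurable.comp ((refl_meas.comp measurable_fst).sub measurable_snd))

lemma guhp_symm (x y : ℝ × ℝ) : GUHP x y = GUHP y x := by
  rw [guhp_eq, guhp_eq, gk_sub_comm]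
  congr 1
  simp only [gk, rad, reflPt, Prod.fst_sub, Prod.snd_sub]
  congr 3
  ring

lemma guhp_bounds {x y : ℝ × ℝ} (hx : x ∈ UHP) (hy : y ∈ UHP) (hxy : y ≠ x) :
    0 ≤ GUHP x y ∧ GUHP x y ≤ gk (x - y) := by
  have hx : 0 < x.2 := hx
  have hy : 0 < y.2 := hy
  rw [guhp_eq]
  refine ⟨?_, by linarith [gk_nonneg (reflPt x - y)]⟩
  have h : K0 (rad (reflPt x - y)) ≤ K0 (rad (x - y)) := by
    refine k0_anti (rad_pos (sub_ne_zero.2 hxy.symm)) ?_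
    apply Real.sqrt_le_sqrt
    simp only [reflPt, Prod.fst_sub, Prod.snd_sub]
    nlinarith
  have h2 : 0 < 1 / (2 * π) := by positivity
  unfold gk
  nlinarith

lemma guhp_ae (x : ℝ × ℝ) (hx : x ∈ UHP) :
    ∀ᵐ y ∂mU, 0 ≤ GUHP x y ∧ GUHP x y ≤ gk (x - y) := by
  have h1 : ∀ᵐ y ∂mU, y ≠ x := ae_restrict_of_ae (by simp [ae_iff])
  filter_upwards [h1, ae_restrict_mem uhp_meas] with y h h'
  exact guhp_bounds hx h' h

lemma guhp_ae_prod :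
    ∀ᵐ p ∂(mU.prod mU), 0 ≤ GUHP p.1 p.2 ∧ GUHP p.1 p.2 ≤ gk (p.1 - p.2) := by
  have hm : MeasurableSet {p : (ℝ × ℝ) × (ℝ × ℝ) |
      0 ≤ GUHP p.1 p.2 ∧ GUHP p.1 p.2 ≤ gk (p.1 - p.2)} :=
    (measurableSet_le measurable_const guhp_meas).inter (measurableSet_le guhp_meas
      (gk_measurable.comp (measurable_fst.sub measurable_snd)))
  refine (Measure.ae_prod_iff_ae_ae hm).2 ?_
  filter_upwards [ae_restrict_mem uhp_meas] with x hx
  exact guhp_ae x hx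

lemma refl_mp : MeasurePreserving reflPt (volume : Measure (ℝ × ℝ)) volume := by
  have := (MeasurePreserving.id (volume : Measure ℝ)).prod
    (Measure.measurePreserving_neg (volume : Measure ℝ))
  exact this

lemma refl_emb : MeasurableEmbedding reflPt := by
  have : reflPt = (Homeomorph.refl ℝ).prodCongr (Homeomorph.neg ℝ) := by
    ext x <;> simp [reflPt]
  rw [this]
  exact Homeomorph.measurableEmbedding _

lemma odd_integral (P : ℝ → ℝ) (hP : ∀ t, P (-t) = - P t) (y : ℝ × ℝ)
    (hi : Integrable (fun z : ℝ × ℝ => P (z.2 + y.2) * gk z)) :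
    ∫ x in UHP, P x.2 * GUHP x y = ∫ z : ℝ × ℝ, P (z.2 + y.2) * gk z := by
  set F : ℝ × ℝ → ℝ := fun x => P x.2 * gk (x - y) with hF
  have hFi : Integrable F := by
    have := hi.comp_sub_right y
    refine this.congr (Eventually.of_forall fun x => ?_)
    simp [hF]
  have hFe : ∫ x, F x = ∫ z : ℝ × ℝ, P (z.2 + y.2) * gk z := by
    rw [← integral_sub_right_eq_self (fun z : ℝ × ℝ => P (z.2 + y.2) * gk z) y]
    congr 1
    ext x
    simp [hF]
  have hcomp : Integrable (fun x => F (reflPt x)) :=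
    (refl_mp.integrable_comp_emb refl_emb).2 hFi
  have hset : ∫ x in UHP, F (reflPt x) = ∫ x in UHPᶜ, F x := by
    have h1 := refl_mp.setIntegral_preimage_emb refl_emb F {x | x.2 < 0}
    have h2 : reflPt ⁻¹' {x | x.2 < 0} = UHP := by
      ext x; simp [reflPt, UHP]
    rw [h2] at h1
    rw [h1]
    refine setIntegral_congr_set ?_
    have h0 : ∀ᵐ x : ℝ × ℝ, x.2 ≠ 0 := by
      have : ∀ᵐ x : ℝ, x ≠ 0 := by simp [ae_iff]
      exact Measure.quasiMeasurePreserving_snd.ae this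
    filter_upwards [h0] with x hx
    apply propext
    change x.2 < 0 ↔ ¬ (0 < x.2)
    rw [not_lt]
    exact ⟨le_of_lt, fun h => lt_of_le_of_ne h hx⟩
  have : ∀ x, P x.2 * GUHP x y = F x + F (reflPt x) := by
    intro x
    simp only [hF, guhp_eq, reflPt, hP]
    ring
  simp_rw [this]
  rw [integral_add hFi.integrableOn hcomp.integrableOn, hset, integral_add_compl uhp_meas hFi, hFe]

lemma snd_gk_integral : ∫ z : ℝ × ℝ, z.2 * gk z = 0 := by
  have h := integral_neg_eq_self (fun z : ℝ × ℝ => z.2 * gk z) volume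
  simp only [Prod.snd_neg, gk_neg, neg_mul] at h
  rw [integral_neg] at h
  linarith

lemma guhp_snd_integral (y : ℝ × ℝ) : ∫ x in UHP, x.2 * GUHP x y = y.2 := by
  have e : ∀ z : ℝ × ℝ, (z.2 + y.2) * gk z = z.2 * gk z + y.2 * gk z := fun z => by ring
  have hi := gk_integrable.const_mul y.2
  refine (odd_integral (fun t => t) (fun t => rfl) y ?_).trans ?_
  rotate_left
  · simp only [e]
    rw [integral_add snd_gk_integrable hi, snd_gk_integral, integral_const_mul, gk_integral]
    ring
  · simp only [e]
    exact snd_gk_integrable.add hi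

lemma guhp_one_integral {y : ℝ × ℝ} (hy : y ∈ UHP) : ∫ x in UHP, GUHP x y ≤ stripC * y.2 := by
  have hy : 0 < y.2 := hy
  let P : ℝ → ℝ := fun t => if 0 < t then 1 else if t < 0 then -1 else 0
  have hPm : Measurable P := Measurable.ite (measurableSet_lt measurable_const measurable_id)
    measurable_const (Measurable.ite (measurableSet_lt measurable_id measurable_const)
      measurable_const measurable_const)
  have hPb : ∀ t, |P t| ≤ 1 := by
    intro t
    simp only [P]
    split_ifs <;> simp
  have hPo : ∀ t, P (-t) = - P t := by
    intro t
    simp only [P]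
    split_ifs <;> linarith
  have hi : Integrable (fun z : ℝ × ℝ => P (z.2 + y.2) * gk z) := by
    refine gk_integrable.mono' ?_ (Eventually.of_forall fun z => ?_)
    · exact ((hPm.comp (measurable_snd.add_const _)).mul gk_measurable).aestronglyMeasurable
    · rw [Real.norm_eq_abs, abs_mul, abs_of_nonneg (gk_nonneg z)]
      exact mul_le_of_le_one_left (gk_nonneg z) (hPb _)
  have h1 := odd_integral P hPo y hi
  have h2 : ∫ x in UHP, GUHP x y = ∫ x in UHP, P x.2 * GUHP x y := by
    refine setIntegral_congr_fun uhp_meas fun x hx => ?_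
    have hx : 0 < x.2 := hx
    simp [P, hx]
  have h3 := integral_neg_eq_self (fun z : ℝ × ℝ => P (z.2 + y.2) * gk z) volume
  have h4 : ∫ z : ℝ × ℝ, P (z.2 + y.2) * gk z
      = ∫ z : ℝ × ℝ, ((1/2) * (P (z.2 + y.2) + P (-z.2 + y.2))) * gk z := by
    have hi' := hi.comp_neg
    simp only [Prod.snd_neg, gk_neg] at h3 hi'
    have e : ∀ z : ℝ × ℝ, ((1/2) * (P (z.2 + y.2) + P (-z.2 + y.2))) * gk z
      = (1/2) * (P (z.2 + y.2) * gk z) + (1/2) * (P (-z.2 + y.2) * gk z) := fun z => by ring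
    simp_rw [e]
    rw [integral_add (hi.const_mul _) (hi'.const_mul _), integral_const_mul, integral_const_mul, h3]
    ring
  rw [h2, h1, h4]
  refine le_trans ?_ (strip_bound hy)
  have hi' := hi.comp_neg
  refine integral_mono ?_ ?_ fun z => ?_
  · have := (hi.const_mul (1/2)).add (hi'.const_mul (1/2))
    refine this.congr (Eventually.of_forall fun z => ?_)
    simp only [Pi.add_apply, Prod.snd_neg, gk_neg]
    ring
  · refine gk_integrable.mono' ?_ (Eventually.of_forall fun z => ?_)
    · exact (((measurable_const.indicator measurableSet_Icc).comp measurable_snd).mul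
        gk_measurable).aestronglyMeasurable
    · rw [Real.norm_eq_abs, abs_mul, abs_of_nonneg (gk_nonneg z)]
      refine mul_le_of_le_one_left (gk_nonneg z) ?_
      by_cases h : z.2 ∈ Set.Icc (-y.2) y.2 <;> simp [h]
  · refine mul_le_mul_of_nonneg_right ?_ (gk_nonneg z)
    by_cases h : z.2 ∈ Set.Icc (-y.2) y.2
    · rw [Set.indicator_of_mem h]
      have h5 := (abs_le.1 (hPb (z.2 + y.2))).2
      have h6 := (abs_le.1 (hPb (-z.2 + y.2))).2
      linarith
    · rw [Set.indicator_of_notMem h]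
      simp only [Set.mem_Icc, not_and_or, not_le] at h
      simp only [P]
      split_ifs <;> rcases h with h | h <;> linarith

/-! ### Integrability on the product -/

lemma conv_integrable {u v : ℝ × ℝ → ℝ} (hu : Integrable u mU) (hv : Integrable v) :
    Integrable (fun p : (ℝ × ℝ) × (ℝ × ℝ) => v (p.1 - p.2) * u p.2) (mU.prod mU) := by
  have h := hu.convolution_integrand (ContinuousLinearMap.mul ℝ ℝ) hv
  simp only [ContinuousLinearMap.mul_apply'] at h
  have h2 := h.integrableOn (s := UHP ×ˢ Set.univ)
  rw [IntegrableOn, ← Measure.prod_restrict, Measure.restrict_univ] at h2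
  refine h2.congr (Eventually.of_forall fun p => ?_)
  simp only [mul_comm]

lemma conv_integral_le {u v : ℝ × ℝ → ℝ} (hu : Integrable u mU) (hv : Integrable v)
    (hu0 : ∀ᵐ x ∂mU, 0 ≤ u x) (hv0 : ∀ x, 0 ≤ v x) :
    ∫ p : (ℝ × ℝ) × (ℝ × ℝ), v (p.1 - p.2) * u p.2 ∂(mU.prod mU) ≤
      (∫ x, v x) * ∫ x in UHP, u x := by
  rw [integral_prod_symm _ (conv_integrable hu hv)]
  simp only [integral_mul_const]
  rw [← integral_const_mul]
  refine integral_mono_of_nonneg ?_ (hu.const_mul _) ?_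
  · filter_upwards [hu0] with x hx
    exact mul_nonneg (integral_nonneg fun _ => hv0 _) hx
  · filter_upwards [hu0] with x hx
    refine mul_le_mul_of_nonneg_right ?_ hx
    refine (setIntegral_le_integral (hv.comp_sub_right x)
      (Eventually.of_forall fun _ => hv0 _)).trans_eq ?_
    exact integral_sub_right_eq_self v x

/-- The bilinear form. -/
noncomputable def TT (f h : ℝ × ℝ → ℝ) : ℝ :=
  ∫ p : (ℝ × ℝ) × (ℝ × ℝ), f p.1 * (GUHP p.1 p.2 * h p.2) ∂(mU.prod mU)

lemma tt_integrable {f h : ℝ × ℝ → ℝ} (hf : MemLp f 2 mU) (hh : MemLp h 2 mU) :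
    Integrable (fun p : (ℝ × ℝ) × (ℝ × ℝ) => f p.1 * (GUHP p.1 p.2 * h p.2)) (mU.prod mU) := by
  have h1 := conv_integrable hh.integrable_sq gk_integrable
  have h2 := (conv_integrable hf.integrable_sq gk_integrable).swap
  have h3 := (h1.add h2).const_mul (1/2)
  refine h3.mono' ?_ ?_
  · exact hf.1.comp_fst.mul (guhp_meas.aestronglyMeasurable.mul hh.1.comp_snd)
  · filter_upwards [guhp_ae_prod] with p hp
    simp only [Pi.add_apply, Function.comp_apply, Prod.fst_swap, Prod.snd_swap]
    rw [gk_sub_comm p.2 p.1, Real.norm_eq_abs, abs_mul, abs_mul, abs_of_nonneg hp.1]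
    have h4 : 0 ≤ |f p.1| * |h p.2| := by positivity
    have h5 : |f p.1| * |h p.2| ≤ 1/2 * (h p.2 ^ 2 + f p.1 ^ 2) := by
      rw [← sq_abs (h p.2), ← sq_abs (f p.1)]
      nlinarith [sq_nonneg (|f p.1| - |h p.2|)]
    have h6 := gk_nonneg (p.1 - p.2)
    calc |f p.1| * (GUHP p.1 p.2 * |h p.2|) = GUHP p.1 p.2 * (|f p.1| * |h p.2|) := by ring
      _ ≤ gk (p.1 - p.2) * (|f p.1| * |h p.2|) := mul_le_mul_of_nonneg_right hp.2 h4
      _ ≤ gk (p.1 - p.2) * (1/2 * (h p.2 ^ 2 + f p.1 ^ 2)) := mul_le_mul_of_nonneg_left h5 h6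
      _ = _ := by ring

lemma tt_eq {f h : ℝ × ℝ → ℝ} (hf : MemLp f 2 mU) (hh : MemLp h 2 mU) :
    TT f h = ∫ x in UHP, f x * Gop h x := by
  rw [TT, integral_prod _ (tt_integrable hf hh)]
  simp only [integral_const_mul]
  rfl

lemma gop_integrable {f h : ℝ × ℝ → ℝ} (hf : MemLp f 2 mU) (hh : MemLp h 2 mU) :
    Integrable (fun x => f x * Gop h x) mU := by
  have := (tt_integrable hf hh).integral_prod_left
  simp only [integral_const_mul] at this
  exact this

lemma tt_symm (f h : ℝ × ℝ → ℝ) : TT f h = TT h f := by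
  rw [TT, ← integral_prod_swap]
  refine integral_congr_ae (Eventually.of_forall fun p => ?_)
  simp only [Prod.fst_swap, Prod.snd_swap]
  rw [guhp_symm]
  ring

lemma tt_expand {w h : ℝ × ℝ → ℝ} (hw : MemLp w 2 mU) (hh : MemLp h 2 mU) (s : ℝ) :
    TT (fun x => w x + s * h x) (fun x => w x + s * h x)
      = TT w w + 2 * s * TT h w + s ^ 2 * TT h h := by
  have e : ∀ p : (ℝ × ℝ) × (ℝ × ℝ),
      (w p.1 + s * h p.1) * (GUHP p.1 p.2 * (w p.2 + s * h p.2))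
      = (w p.1 * (GUHP p.1 p.2 * w p.2) + s * (h p.1 * (GUHP p.1 p.2 * w p.2)))
        + (s * (w p.1 * (GUHP p.1 p.2 * h p.2)) + s ^ 2 * (h p.1 * (GUHP p.1 p.2 * h p.2))) :=
    fun p => by ring
  have i1 := tt_integrable hw hw
  have i2 := (tt_integrable hh hw).const_mul s
  have i3 := (tt_integrable hw hh).const_mul s
  have i4 := (tt_integrable hh hh).const_mul (s ^ 2)
  rw [TT]
  simp_rw [e]
  rw [integral_add (i1.fun_add i2) (i3.fun_add i4), integral_add i1 i2, integral_add i3 i4]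
  simp only [integral_const_mul]
  change TT w w + s * TT h w + (s * TT w h + s ^ 2 * TT h h) = _
  rw [tt_symm w h]
  ring

/-! ### Upper bound for the energy -/

lemma gk_tail {ε : ℝ} (hε : 0 < ε) : ∃ M : ℝ, 0 ≤ M ∧ ∫ z, max (gk z - M) 0 ≤ ε := by
  have h : Tendsto (fun n : ℕ => ∫ z, max (gk z - n) 0) atTop (nhds (∫ _ : ℝ × ℝ, (0:ℝ))) := by
    refine tendsto_integral_of_dominated_convergence gk (fun n => ?_) gk_integrable (fun n => ?_) ?_
    · exact ((gk_measurable.sub_const _).max measurable_const).aestronglyMeasurable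
    · refine Eventually.of_forall fun z => ?_
      rw [Real.norm_eq_abs, abs_of_nonneg (le_max_right _ _)]
      exact max_le (by have : (0:ℝ) ≤ n := n.cast_nonneg
                       linarith) (gk_nonneg z)
    · refine Eventually.of_forall fun z => ?_
      obtain ⟨N, hN⟩ := exists_nat_ge (gk z)
      refine tendsto_const_nhds.congr' ?_
      filter_upwards [eventually_ge_atTop N] with n hn
      rw [max_eq_right]
      have : (N:ℝ) ≤ n := by exact_mod_cast hn
      linarith
  simp only [integral_zero] at h
  obtain ⟨n, hn⟩ := (h.eventually (eventually_le_nhds hε)).exists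
  exact ⟨n, n.cast_nonneg, hn⟩

lemma tt_upper {ε : ℝ} (hε : 0 < ε) : ∃ M : ℝ, 0 ≤ M ∧ ∀ w : ℝ × ℝ → ℝ, MemLp w 2 mU →
    Integrable w mU → (∀ x ∈ UHP, 0 ≤ w x) →
    TT w w ≤ ε * (∫ x in UHP, w x ^ 2) + M * (∫ x in UHP, w x) ^ 2 := by
  obtain ⟨M, hM, hMe⟩ := gk_tail hε
  refine ⟨M, hM, fun w hw2 hw1 hw0 => ?_⟩
  set v : ℝ × ℝ → ℝ := fun z => max (gk z - M) 0 with hv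
  have hvi : Integrable v := by
    refine gk_integrable.mono'
      ((gk_measurable.sub_const _).max measurable_const).aestronglyMeasurable
      (Eventually.of_forall fun z => ?_)
    rw [Real.norm_eq_abs, abs_of_nonneg (le_max_right _ _)]
    exact max_le (by linarith) (gk_nonneg z)
  have hv0 : ∀ z, 0 ≤ v z := fun z => le_max_right _ _
  have hvs : ∀ x y, v (x - y) = v (y - x) := fun x y => by simp only [hv, gk_sub_comm]
  have h1 := conv_integrable hw2.integrable_sq hvi
  have h2 := h1.swap
  have h3 := hw1.mul_prod hw1
  have hle : TT w w ≤ ∫ p : (ℝ × ℝ) × (ℝ × ℝ), (M * (w p.1 * w p.2) +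
      (1/2 * (v (p.1 - p.2) * w p.2 ^ 2) + 1/2 * (v (p.2 - p.1) * w p.1 ^ 2))) ∂(mU.prod mU) := by
    refine integral_mono_ae (tt_integrable hw2 hw2) ((h3.const_mul M).add
      ((h1.const_mul (1/2)).add (h2.const_mul (1/2)))) ?_
    have hmem : ∀ᵐ p ∂(mU.prod mU), p ∈ UHP ×ˢ UHP := by
      rw [Measure.prod_restrict]
      exact ae_restrict_mem (uhp_meas.prod uhp_meas)
    filter_upwards [guhp_ae_prod, hmem] with p hp hpm
    have a1 := hw0 _ hpm.1
    have a2 := hw0 _ hpm.2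
    rw [hvs p.2 p.1]
    have a3 : gk (p.1 - p.2) ≤ M + v (p.1 - p.2) := by
      have := le_max_left (gk (p.1 - p.2) - M) 0
      simp only [hv]
      linarith
    have a4 := hv0 (p.1 - p.2)
    have a5 : 0 ≤ w p.1 * w p.2 := mul_nonneg a1 a2
    calc w p.1 * (GUHP p.1 p.2 * w p.2) = GUHP p.1 p.2 * (w p.1 * w p.2) := by ring
      _ ≤ (M + v (p.1 - p.2)) * (w p.1 * w p.2) :=
        mul_le_mul_of_nonneg_right (hp.2.trans a3) a5
      _ = M * (w p.1 * w p.2) + v (p.1 - p.2) * (w p.1 * w p.2) := by ring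
      _ ≤ M * (w p.1 * w p.2) + v (p.1 - p.2) * (1/2 * w p.2 ^ 2 + 1/2 * w p.1 ^ 2) := by
        gcongr
        nlinarith [sq_nonneg (w p.1 - w p.2)]
      _ = _ := by ring
  refine hle.trans ?_
  have hc := conv_integral_le hw2.integrable_sq hvi
    (Eventually.of_forall fun x => sq_nonneg _) hv0
  have hc2 : ∫ p : (ℝ × ℝ) × (ℝ × ℝ), v (p.2 - p.1) * w p.1 ^ 2 ∂(mU.prod mU)
      = ∫ p : (ℝ × ℝ) × (ℝ × ℝ), v (p.1 - p.2) * w p.2 ^ 2 ∂(mU.prod mU) :=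
    integral_prod_swap (fun p : (ℝ × ℝ) × (ℝ × ℝ) => v (p.1 - p.2) * w p.2 ^ 2)
  have h2' : Integrable (fun p : (ℝ × ℝ) × (ℝ × ℝ) => v (p.2 - p.1) * w p.1 ^ 2)
    (mU.prod mU) := h2
  rw [integral_add (h3.const_mul M) ((h1.const_mul (1/2)).fun_add (h2'.const_mul (1/2))),
    integral_add (h1.const_mul (1/2)) (h2'.const_mul (1/2)), integral_const_mul,
    integral_const_mul, integral_const_mul, hc2, integral_prod_mul w w]
  have h6 : (∫ x, v x) * (∫ x in UHP, w x ^ 2) ≤ ε * ∫ x in UHP, w x ^ 2 :=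
    mul_le_mul_of_nonneg_right hMe (integral_nonneg fun _ => sq_nonneg _)
  nlinarith

/-! ### Variational part -/

lemma adm_memLp {μ ν : ℝ} {w : ℝ × ℝ → ℝ} (h : InAdm μ ν w) : MemLp w 2 mU :=
  (memLp_two_iff_integrable_sq h.2.1.1).2 h.2.2.1

lemma efun_eq {lam : ℝ} {w : ℝ × ℝ → ℝ} (h : MemLp w 2 mU) :
    Efun lam w = (1/2) * TT w w - (1 / (2 * lam)) * ∫ x in UHP, w x ^ 2 := by
  rw [Efun, kineticE, tt_eq h h]

lemma energy_bdd {lam : ℝ} (hlam : 0 < lam) (μ ν : ℝ) :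
    BddAbove {s | ∃ w, InAdm μ ν w ∧ s = Efun lam w} := by
  obtain ⟨M, hM, h⟩ := tt_upper (ε := 1 / lam) (by positivity)
  refine ⟨1/2 * (M * ν ^ 2), ?_⟩
  rintro s ⟨w, hw, rfl⟩
  have hm := adm_memLp hw
  have h1 := h w hm hw.2.1 hw.1
  rw [efun_eq hm]
  have h2 : 0 ≤ ∫ x in UHP, w x := setIntegral_nonneg uhp_meas hw.1
  have h3 : (∫ x in UHP, w x) ^ 2 ≤ ν ^ 2 := pow_le_pow_left₀ h2 hw.2.2.2.2.2 2
  have h4 : M * (∫ x in UHP, w x) ^ 2 ≤ M * ν ^ 2 := mul_le_mul_of_nonneg_left h3 hM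
  have h5 : 1 / (2 * lam) * ∫ x in UHP, w x ^ 2 = 1/2 * (1 / lam * ∫ x in UHP, w x ^ 2) := by
    field_simp
  rw [h5]
  linarith

lemma first_order {lam μ ν : ℝ} (hlam : 0 < lam) {w h : ℝ × ℝ → ℝ} (hw : IsMaximizer lam μ ν w)
    (hh : MemLp h 2 mU) (hh1 : Integrable h mU) (hh2 : Integrable (fun x => x.2 * h x) mU)
    (him : ∫ x in UHP, x.2 * h x = 0) {s₀ : ℝ} (hs₀ : 0 < s₀)
    (hpos : ∀ x ∈ UHP, 0 ≤ w x + s₀ * h x)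
    (hmass : (∫ x in UHP, w x) + s₀ * (∫ x in UHP, h x) ≤ ν) :
    TT h w - (1 / lam) * ∫ x in UHP, h x * w x ≤ 0 := by
  obtain ⟨hadm, hE⟩ := hw
  have hwm := adm_memLp hadm
  have hhw : Integrable (fun x => h x * w x) mU := hh.integrable_mul hwm
  set A := TT h w - (1 / lam) * ∫ x in UHP, h x * w x with hA
  set B := 1/2 * TT h h - 1 / (2 * lam) * ∫ x in UHP, h x ^ 2 with hB
  have key : ∀ s, 0 < s → s ≤ s₀ → s * A + s ^ 2 * B ≤ 0 := by
    intro s hs hss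
    have hm' : MemLp (fun x => w x + s * h x) 2 mU := hwm.add (hh.const_mul s)
    have hadm' : InAdm μ ν (fun x => w x + s * h x) := by
      refine ⟨fun x hx => ?_, hadm.2.1.add (hh1.const_mul s), hm'.integrable_sq, ?_, ?_, ?_⟩
      · have h1 := hpos x hx
        have h2 := hadm.1 x hx
        by_cases h3 : 0 ≤ h x
        · positivity
        · push Not at h3
          nlinarith
      · have := Integrable.add hadm.2.2.2.1 (hh2.const_mul s)
        refine this.congr (Eventually.of_forall fun x => ?_)
        simp only [Pi.add_apply]
        ring
      · have e : ∀ x : ℝ × ℝ, x.2 * (w x + s * h x) = x.2 * w x + s * (x.2 * h x) :=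
          fun x => by ring
        simp only [impulse, e]
        rw [integral_add hadm.2.2.2.1 (hh2.const_mul s), integral_const_mul, him, mul_zero,
          add_zero]
        exact hadm.2.2.2.2.1
      · rw [integral_add hadm.2.1 (hh1.const_mul s), integral_const_mul]
        have h2 := hadm.2.2.2.2.2
        by_cases h3 : 0 ≤ ∫ x in UHP, h x
        · nlinarith
        · push Not at h3
          nlinarith
    have hle : Efun lam (fun x => w x + s * h x) ≤ Efun lam w := by
      rw [hE]
      exact le_csSup (energy_bdd hlam μ ν) ⟨_, hadm', rfl⟩
    rw [efun_eq hm', efun_eq hwm, tt_expand hwm hh s] at hle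
    have e : ∀ x, (w x + s * h x) ^ 2 = w x ^ 2 + (2 * s * (h x * w x) + s ^ 2 * h x ^ 2) :=
      fun x => by ring
    simp only [e] at hle
    rw [integral_add hwm.integrable_sq ((hhw.const_mul _).fun_add (hh.integrable_sq.const_mul _)),
      integral_add (hhw.const_mul _) (hh.integrable_sq.const_mul _), integral_const_mul,
      integral_const_mul] at hle
    have e2 : 1 / (2 * lam) = 1/2 * (1 / lam) := by field_simp
    rw [hA, hB]
    rw [e2] at hle ⊢
    nlinarith
  by_contra hcon
  push Not at hcon
  have hs1 : 0 < min s₀ (A / (2 * (|B| + 1))) := lt_min hs₀ (by positivity)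
  set s := min s₀ (A / (2 * (|B| + 1))) with hs
  have h1 := key s hs1 (min_le_left _ _)
  have h2 : s * (2 * (|B| + 1)) ≤ A := by
    rw [← le_div_iff₀ (by positivity)]
    exact min_le_right _ _
  have h3 := neg_abs_le B
  have h4 : 0 < A + s * B := by nlinarith [abs_nonneg B]
  nlinarith

/-- bounded boxes exhausting the half plane -/
def Bx (n : ℕ) : Set (ℝ × ℝ) := {x | 0 < x.2 ∧ |x.1| ≤ n + 1 ∧ x.2 ≤ n + 1}

lemma bx_meas (n : ℕ) : MeasurableSet (Bx n) := by
  apply MeasurableSet.inter (measurableSet_lt measurable_const measurable_snd)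
  exact MeasurableSet.inter
    (measurableSet_le (continuous_fst.abs.measurable) measurable_const)
    (measurableSet_le measurable_snd measurable_const)

lemma bx_fin (n : ℕ) : mU (Bx n) < ⊤ := by
  refine (Measure.restrict_apply_le _ _).trans_lt ?_
  have : Bx n ⊆ Set.Icc (-((n:ℝ) + 1)) (n + 1) ×ˢ Set.Icc 0 ((n:ℝ) + 1) := by
    rintro x ⟨h1, h2, h3⟩
    exact ⟨abs_le.1 h2, h1.le, h3⟩
  exact (measure_mono this).trans_lt
    ((isCompact_Icc.prod isCompact_Icc).measure_lt_top)

lemma bx_fin' {A : Set (ℝ × ℝ)} {n : ℕ} (h : A ⊆ Bx n) : mU A < ⊤ :=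
  (measure_mono h).trans_lt (bx_fin n)

lemma bx_ind_memLp {A : Set (ℝ × ℝ)} {n : ℕ} (hA : MeasurableSet A) (h : A ⊆ Bx n) :
    MemLp (A.indicator (fun _ => (1:ℝ))) 2 mU :=
  memLp_indicator_const 2 hA 1 (Or.inr (bx_fin' h).ne)

lemma bx_ind_int {A : Set (ℝ × ℝ)} {n : ℕ} (hA : MeasurableSet A) (h : A ⊆ Bx n) :
    Integrable (A.indicator (fun _ => (1:ℝ))) mU := by
  rw [integrable_indicator_iff hA]
  exact integrableOn_const (bx_fin' h).ne

lemma bx_snd_int {A : Set (ℝ × ℝ)} {n : ℕ} (hA : MeasurableSet A) (h : A ⊆ Bx n) :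
    IntegrableOn (fun x : ℝ × ℝ => x.2) A mU := by
  refine Integrable.mono' (integrableOn_const (C := (n:ℝ) + 1) (bx_fin' h).ne)
    measurable_snd.aestronglyMeasurable ?_
  refine (ae_restrict_iff' hA).2 (Eventually.of_forall fun x hx => ?_)
  obtain ⟨h1, h2, h3⟩ := h hx
  rw [Real.norm_eq_abs, abs_of_pos h1]
  exact h3

/-- The derivative of the energy. -/
noncomputable def ph (lam : ℝ) (w : ℝ × ℝ → ℝ) (x : ℝ × ℝ) : ℝ := Gop w x - (1 / lam) * w x

lemma ind_mul_eq (A : Set (ℝ × ℝ)) (f : ℝ × ℝ → ℝ) :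
    (fun x => A.indicator (fun _ => (1:ℝ)) x * f x) = A.indicator f := by
  ext x
  by_cases h : x ∈ A <;> simp [h]

lemma ind_mul_eq' (A : Set (ℝ × ℝ)) (f : ℝ × ℝ → ℝ) :
    (fun x => f x * A.indicator (fun _ => (1:ℝ)) x) = A.indicator f := by
  ext x
  by_cases h : x ∈ A <;> simp [h]

lemma bx_gop_int {w : ℝ × ℝ → ℝ} (hw : MemLp w 2 mU) {A : Set (ℝ × ℝ)} {n : ℕ}
    (hA : MeasurableSet A) (h : A ⊆ Bx n) : IntegrableOn (Gop w) A mU := by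
  have := gop_integrable (bx_ind_memLp hA h) hw
  rwa [ind_mul_eq, integrable_indicator_iff hA] at this

lemma bx_ph_int {lam : ℝ} {w : ℝ × ℝ → ℝ} (hw : MemLp w 2 mU) (hw1 : Integrable w mU)
    {A : Set (ℝ × ℝ)} {n : ℕ}
    (hA : MeasurableSet A) (h : A ⊆ Bx n) : IntegrableOn (ph lam w) A mU :=
  (bx_gop_int hw hA h).sub (hw1.integrableOn.const_mul _)

lemma two_set {lam μ ν : ℝ} (hlam : 0 < lam) {w : ℝ × ℝ → ℝ} (hw : IsMaximizer lam μ ν w)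
    {A D : Set (ℝ × ℝ)} {n k : ℕ} (hA : MeasurableSet A) (hAn : A ⊆ Bx n)
    (hD : MeasurableSet D) (hDk : D ⊆ Bx k) (a b : ℝ) {s₀ : ℝ} (hs₀ : 0 < s₀)
    (him : a * (∫ x in A, x.2 ∂mU) + b * (∫ x in D, x.2 ∂mU) = 0)
    (hpos : ∀ x ∈ UHP, 0 ≤ w x +
      s₀ * (a * A.indicator (fun _ => (1:ℝ)) x + b * D.indicator (fun _ => (1:ℝ)) x))
    (hmass : (∫ x in UHP, w x) + s₀ * (a * mU.real A + b * mU.real D) ≤ ν) :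
    a * (∫ x in A, ph lam w x ∂mU) + b * (∫ x in D, ph lam w x ∂mU) ≤ 0 := by
  have hwm := adm_memLp hw.1
  have hw1 : Integrable w mU := hw.1.2.1
  have mA := bx_ind_memLp hA hAn
  have mD := bx_ind_memLp hD hDk
  have iA := bx_ind_int hA hAn
  have iD := bx_ind_int hD hDk
  have gen : ∀ f : ℝ × ℝ → ℝ, IntegrableOn f A mU → IntegrableOn f D mU →
      Integrable (fun x => f x * (a * A.indicator (fun _ => (1:ℝ)) x +
        b * D.indicator (fun _ => (1:ℝ)) x)) mU ∧
      ∫ x, f x * (a * A.indicator (fun _ => (1:ℝ)) x + b * D.indicator (fun _ => (1:ℝ)) x) ∂mU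
        = a * (∫ x in A, f x ∂mU) + b * (∫ x in D, f x ∂mU) := by
    intro f fA fD
    have e : (fun x => f x * (a * A.indicator (fun _ => (1:ℝ)) x +
        b * D.indicator (fun _ => (1:ℝ)) x)) = fun x => a * A.indicator f x + b * D.indicator f x := by
      ext x
      have h1 := congrFun (ind_mul_eq' A f) x
      have h2 := congrFun (ind_mul_eq' D f) x
      rw [← h1, ← h2]
      ring
    have jA := (integrable_indicator_iff hA).2 fA
    have jD := (integrable_indicator_iff hD).2 fD
    rw [e]
    refine ⟨(jA.const_mul a).add (jD.const_mul b), ?_⟩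
    rw [integral_add (jA.const_mul a) (jD.const_mul b), integral_const_mul, integral_const_mul,
      integral_indicator hA, integral_indicator hD]
  have g2 := gen (fun x => x.2) (bx_snd_int hA hAn) (bx_snd_int hD hDk)
  have g1 := gen (fun _ => 1) (integrableOn_const (bx_fin' hAn).ne) (integrableOn_const (bx_fin' hDk).ne)
  have gp := gen (ph lam w) (bx_ph_int hwm hw1 hA hAn) (bx_ph_int hwm hw1 hD hDk)
  simp only [one_mul] at g1
  have mh : MemLp (fun x => a * A.indicator (fun _ => (1:ℝ)) x +
        b * D.indicator (fun _ => (1:ℝ)) x) 2 mU := (mA.const_mul a).add (mD.const_mul b)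
  have := first_order hlam hw mh g1.1 g2.1 (g2.2.trans him) hs₀ hpos (by
    rw [g1.2]
    simpa using hmass)
  rw [← gp.2]
  refine le_trans (le_of_eq ?_) this
  have hmw : Integrable (fun x => (a * A.indicator (fun _ => (1:ℝ)) x +
        b * D.indicator (fun _ => (1:ℝ)) x) * w x) mU := mh.integrable_mul hwm
  rw [tt_eq mh hwm, ← integral_const_mul, ← integral_sub (gop_integrable mh hwm)
    (hmw.const_mul (1 / lam))]
  refine integral_congr_ae (Eventually.of_forall fun x => ?_)
  simp only [ph]
  ring

lemma ae_set_nonneg {f : ℝ × ℝ → ℝ} {P : Set (ℝ × ℝ)} (hP : MeasurableSet P)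
    (hi : IntegrableOn f P mU)
    (h : ∀ A, MeasurableSet A → A ⊆ P → 0 ≤ ∫ x in A, f x ∂mU) :
    ∀ᵐ x ∂mU, x ∈ P → 0 ≤ f x := by
  rw [← ae_restrict_iff' hP]
  refine ae_nonneg_of_forall_setIntegral_nonneg hi fun s hs _ => ?_
  rw [Measure.restrict_restrict hs]
  exact h _ (hs.inter hP) Set.inter_subset_right

/-- truncated support -/
def Pn (w : ℝ × ℝ → ℝ) (n : ℕ) : Set (ℝ × ℝ) := Bx n ∩ {x | 1 / ((n:ℝ) + 1) ≤ w x}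

lemma pn_meas {w : ℝ × ℝ → ℝ} (hw : Measurable w) (n : ℕ) : MeasurableSet (Pn w n) :=
  (bx_meas n).inter (measurableSet_le measurable_const hw)

lemma pn_sub (w : ℝ × ℝ → ℝ) (n : ℕ) : Pn w n ⊆ Bx n := Set.inter_subset_left

lemma mem_bx {x : ℝ × ℝ} (hx : x ∈ UHP) {n : ℕ} (h1 : |x.1| ≤ n) (h2 : x.2 ≤ n) : x ∈ Bx n :=
  ⟨hx, by linarith, by linarith⟩

lemma exists_bx {x : ℝ × ℝ} (hx : x ∈ UHP) : ∃ n, x ∈ Bx n := by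
  obtain ⟨n, hn⟩ := exists_nat_ge (max |x.1| x.2)
  exact ⟨n, mem_bx hx ((le_max_left _ _).trans hn) ((le_max_right _ _).trans hn)⟩

lemma exists_pn {w : ℝ × ℝ → ℝ} {x : ℝ × ℝ} (hx : x ∈ UHP) (hw : 0 < w x) : ∃ n, x ∈ Pn w n := by
  obtain ⟨n, hn⟩ := exists_nat_ge (max (max |x.1| x.2) (1 / w x))
  have h1 := (le_max_left _ _).trans hn
  have h2 := (le_max_right _ _).trans hn
  refine ⟨n, mem_bx hx ((le_max_left _ _).trans h1) ((le_max_right _ _).trans h1), ?_⟩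
  change 1 / ((n:ℝ) + 1) ≤ w x
  rw [div_le_iff₀ (by positivity)]
  rw [div_le_iff₀ hw] at h2
  nlinarith

lemma bx_snd_nonneg {A : Set (ℝ × ℝ)} {n : ℕ} (hA : MeasurableSet A) (h : A ⊆ Bx n) :
    0 ≤ ∫ x in A, x.2 ∂mU :=
  setIntegral_nonneg hA fun _ hx => (h hx).1.le

lemma bx_snd_le {A : Set (ℝ × ℝ)} {n : ℕ} (hA : MeasurableSet A) (h : A ⊆ Bx n) :
    ∫ x in A, x.2 ∂mU ≤ (n + 1) * mU.real A := by
  have := setIntegral_mono_on (bx_snd_int hA h)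
    (integrableOn_const (C := (n:ℝ) + 1) (bx_fin' h).ne) hA fun x hx => (h hx).2.2
  refine this.trans_eq ?_
  rw [setIntegral_const, smul_eq_mul, mul_comm]

lemma gop_nonneg {w : ℝ × ℝ → ℝ} (hw : ∀ x ∈ UHP, 0 ≤ w x) {x : ℝ × ℝ} (hx : x ∈ UHP) :
    0 ≤ Gop w x := by
  refine integral_nonneg_of_ae ?_
  filter_upwards [guhp_ae x hx, mU_ae hw] with y h1 h2
  exact mul_nonneg h1.1 h2

/-- far away unit squares -/
def Qs (n j : ℕ) : Set (ℝ × ℝ) :=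
  Set.Icc (j:ℝ) (j + 1) ×ˢ Set.Icc ((n:ℝ) + 1) (n + 2)

lemma qs_meas (n j : ℕ) : MeasurableSet (Qs n j) := measurableSet_Icc.prod measurableSet_Icc

lemma qs_sub (n j : ℕ) : Qs n j ⊆ Bx (n + j + 2) := by
  rintro x ⟨⟨h1, h2⟩, h3, h4⟩
  have hn : (0:ℝ) ≤ n := n.cast_nonneg
  have hj : (0:ℝ) ≤ j := j.cast_nonneg
  refine ⟨by linarith, ?_, ?_⟩ <;> push_cast
  · rw [abs_of_nonneg (by linarith)]; linarith
  · linarith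

lemma qs_vol (n j : ℕ) : mU.real (Qs n j) = 1 := by
  have : mU (Qs n j) = 1 := by
    rw [Measure.restrict_apply (qs_meas n j), Set.inter_eq_left.2 (show Qs n j ⊆ UHP from fun x hx => (qs_sub n j hx).1),
      Qs, Measure.volume_eq_prod, Measure.prod_prod, Real.volume_Icc, Real.volume_Icc]
    norm_num
  simp [Measure.real, this]

lemma qs_snd_ge (n j : ℕ) : (n:ℝ) + 1 ≤ ∫ x in Qs n j, x.2 ∂mU := by
  have := setIntegral_mono_on (integrableOn_const (C := (n:ℝ) + 1) (bx_fin' (qs_sub n j)).ne)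
    (bx_snd_int (qs_meas n j) (qs_sub n j)) (qs_meas n j) fun x hx => hx.2.1
  rwa [setIntegral_const, qs_vol, one_smul] at this

lemma qs_tendsto {w : ℝ × ℝ → ℝ} (hw : Integrable w mU) (n : ℕ) :
    Tendsto (fun j : ℕ => ∫ x in Qs n j, w x ∂mU) atTop (nhds 0) := by
  have h : Tendsto (fun j : ℕ => ∫ x, (Qs n j).indicator w x ∂mU) atTop
      (nhds (∫ _, (0:ℝ) ∂mU)) := by
    refine tendsto_integral_of_dominated_convergence (fun x => |w x|) (fun j => ?_) hw.abs
      (fun j => ?_) ?_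
    · exact hw.1.indicator (qs_meas n j)
    · refine Eventually.of_forall fun x => ?_
      by_cases hx : x ∈ Qs n j <;> simp [hx]
    · refine Eventually.of_forall fun x => ?_
      obtain ⟨N, hN⟩ := exists_nat_gt x.1
      refine tendsto_const_nhds.congr' ?_
      filter_upwards [eventually_ge_atTop N] with j hj
      rw [Set.indicator_of_notMem]
      intro hx
      have : (N:ℝ) ≤ j := by exact_mod_cast hj
      have := hx.1.1
      linarith
  simp only [integral_zero] at h
  refine h.congr fun j => ?_
  rw [integral_indicator (qs_meas n j)]

lemma ph_nonneg {lam μ ν : ℝ} (hlam : 0 < lam) {w : ℝ × ℝ → ℝ} (hwm : Measurable w)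
    (hw : IsMaximizer lam μ ν w) : ∀ᵐ x ∂mU, 0 ≤ ph lam w x := by
  have hw2 := adm_memLp hw.1
  have hw1 : Integrable w mU := hw.1.2.1
  have main : ∀ n, ∀ᵐ x ∂mU, x ∈ Pn w n → 0 ≤ ph lam w x := by
    intro n
    refine ae_set_nonneg (pn_meas hwm n) (bx_ph_int hw2 hw1 (pn_meas hwm n) (pn_sub w n)) ?_
    intro A hA hAP
    have hAn : A ⊆ Bx n := hAP.trans (pn_sub w n)
    set α := ∫ x in A, x.2 ∂mU with hα
    have hα0 : 0 ≤ α := bx_snd_nonneg hA hAn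
    have hα1 : α ≤ (n + 1) * mU.real A := bx_snd_le hA hAn
    have hn : (0:ℝ) < n + 1 := by positivity
    have key : ∀ j : ℕ, -(α / (n + 1) * (1 / lam) * ∫ x in Qs n j, w x ∂mU)
        ≤ ∫ x in A, ph lam w x ∂mU := by
      intro j
      set q := ∫ x in Qs n j, x.2 ∂mU with hq
      have hqn : (n:ℝ) + 1 ≤ q := qs_snd_ge n j
      have hq0 : 0 < q := hn.trans_le hqn
      have h := two_set hlam hw hA hAn (qs_meas n j) (qs_sub n j) (-1) (α / q)
        (s₀ := 1 / ((n:ℝ) + 1)) (by positivity) (by rw [← hα, ← hq]; field_simp; ring) (by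
          intro x hx
          have h0 := hw.1.1 x hx
          have hb : 0 ≤ α / q * (Qs n j).indicator (fun _ => (1:ℝ)) x :=
            mul_nonneg (by positivity) (Set.indicator_nonneg (fun _ _ => zero_le_one) _)
          have hs : 0 < 1 / ((n:ℝ) + 1) := by positivity
          by_cases hxA : x ∈ A
          · have h1 : 1 / ((n:ℝ) + 1) ≤ w x := (hAP hxA).2
            rw [Set.indicator_of_mem hxA]
            nlinarith
          · rw [Set.indicator_of_notMem hxA]
            nlinarith) (by
          have h0 := hw.1.2.2.2.2.2
          rw [qs_vol]
          have h1 : α / q ≤ mU.real A := by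
            rw [div_le_iff₀ hq0]
            have : 0 ≤ mU.real A := measureReal_nonneg
            nlinarith
          have hs : 0 < 1 / ((n:ℝ) + 1) := by positivity
          nlinarith)
      have h2 : -((1 / lam) * ∫ x in Qs n j, w x ∂mU) ≤ ∫ x in Qs n j, ph lam w x ∂mU := by
        rw [← integral_const_mul, ← integral_neg]
        refine setIntegral_mono_on (hw1.integrableOn.const_mul _).neg
          (bx_ph_int hw2 hw1 (qs_meas n j) (qs_sub n j)) (qs_meas n j) fun x hx => ?_
        have := gop_nonneg hw.1.1 (qs_sub n j hx).1
        simp only [ph]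
        linarith
      have h3 : 0 ≤ ∫ x in Qs n j, w x ∂mU :=
        setIntegral_nonneg (qs_meas n j) fun x hx => hw.1.1 x (qs_sub n j hx).1
      have h4 : α / q ≤ α / (n + 1) := div_le_div_of_nonneg_left hα0 hn hqn
      have h5 : 0 ≤ α / q := by positivity
      have h6 : 0 ≤ (1 / lam) * ∫ x in Qs n j, w x ∂mU := mul_nonneg (by positivity) h3
      have h7 := mul_le_mul_of_nonneg_left h2 h5
      have h8 := mul_le_mul_of_nonneg_right h4 h6
      rw [mul_assoc]
      linarith
    have ht := ((qs_tendsto hw1 n).const_mul (α / (n + 1) * (1 / lam))).neg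
    rw [mul_zero, neg_zero] at ht
    exact le_of_tendsto ht (Eventually.of_forall key)
  filter_upwards [ae_all_iff.2 main, ae_restrict_mem uhp_meas] with x h1 hx
  by_cases h : 0 < w x
  · obtain ⟨n, hn⟩ := exists_pn hx h
    exact h1 n hn
  · have h0 : w x = 0 := le_antisymm (not_lt.1 h) (hw.1.1 x hx)
    rw [ph, h0, mul_zero, sub_zero]
    exact gop_nonneg hw.1.1 hx

lemma guhp_w_int {w : ℝ × ℝ → ℝ} (hw1 : Integrable w mU) :
    Integrable (fun p : (ℝ × ℝ) × (ℝ × ℝ) => GUHP p.1 p.2 * w p.2) (mU.prod mU) := by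
  refine (conv_integrable hw1.abs gk_integrable).mono'
    (guhp_meas.aestronglyMeasurable.mul hw1.1.comp_snd) ?_
  filter_upwards [guhp_ae_prod] with p hp
  rw [Real.norm_eq_abs, abs_mul, abs_of_nonneg hp.1]
  exact mul_le_mul_of_nonneg_right hp.2 (abs_nonneg _)

lemma gop_mass {μ ν : ℝ} {w : ℝ × ℝ → ℝ} (hw : InAdm μ ν w) :
    Integrable (Gop w) mU ∧ ∫ x in UHP, Gop w x ≤ stripC * μ := by
  have hw1 : Integrable w mU := hw.2.1
  have hi := guhp_w_int hw1
  refine ⟨hi.integral_prod_left, ?_⟩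
  have h1 : ∫ x in UHP, Gop w x
      = ∫ p : (ℝ × ℝ) × (ℝ × ℝ), GUHP p.1 p.2 * w p.2 ∂(mU.prod mU) := by
    rw [integral_prod _ hi]
    rfl
  have hi2 := hi.integral_prod_right
  rw [h1, integral_prod_symm _ hi]
  simp only [integral_mul_const] at hi2 ⊢
  have h2 : ∫ y in UHP, (∫ x in UHP, GUHP x y) * w y ≤ ∫ y in UHP, stripC * (y.2 * w y) := by
    refine setIntegral_mono_on hi2 (hw.2.2.2.1.const_mul _) uhp_meas fun y hy => ?_
    rw [← mul_assoc]
    exact mul_le_mul_of_nonneg_right (guhp_one_integral hy) (hw.1 y hy)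
  refine h2.trans_eq ?_
  rw [integral_const_mul]
  congr 1
  exact hw.2.2.2.2.1

lemma gop_impulse {μ ν : ℝ} {w : ℝ × ℝ → ℝ} (hw : InAdm μ ν w) :
    ∫ x in UHP, x.2 * Gop w x = μ := by
  have hw1 : Integrable w mU := hw.2.1
  have hi : Integrable (fun p : (ℝ × ℝ) × (ℝ × ℝ) => p.1.2 * (GUHP p.1 p.2 * w p.2))
      (mU.prod mU) := by
    have i1 := conv_integrable hw.2.2.2.1 gk_integrable
    have i2 := conv_integrable hw1 snd_gk_integrable
    refine (i1.add i2).mono (measurable_snd.comp measurable_fst |>.aestronglyMeasurable.mul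
      (guhp_w_int hw1).1) ?_
    filter_upwards [guhp_ae_prod] with p hp
    have e : gk (p.1 - p.2) * (p.2.2 * w p.2) + (p.1 - p.2).2 * gk (p.1 - p.2) * w p.2
        = p.1.2 * (gk (p.1 - p.2) * w p.2) := by
      rw [Prod.snd_sub]; ring
    simp only [Pi.add_apply]
    rw [e, norm_mul, norm_mul, norm_mul, norm_mul]
    gcongr
    rw [Real.norm_eq_abs, Real.norm_eq_abs, abs_of_nonneg hp.1, abs_of_nonneg (gk_nonneg _)]
    exact hp.2
  have h1 : ∫ x in UHP, x.2 * Gop w x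
      = ∫ p : (ℝ × ℝ) × (ℝ × ℝ), p.1.2 * (GUHP p.1 p.2 * w p.2) ∂(mU.prod mU) := by
    rw [integral_prod _ hi]
    simp only [integral_const_mul]
    rfl
  rw [h1, integral_prod_symm _ hi]
  simp only [← mul_assoc, integral_mul_const, guhp_snd_integral]
  exact hw.2.2.2.2.1

lemma exists_small {e₁ e₂ c₁ c₂ : ℝ} (h1 : 0 < e₁) (h2 : 0 < e₂) (h3 : 0 ≤ c₁) (h4 : 0 ≤ c₂) :
    ∃ s : ℝ, 0 < s ∧ s * c₁ ≤ e₁ ∧ s * c₂ ≤ e₂ := by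
  refine ⟨min (e₁ / (c₁ + 1)) (e₂ / (c₂ + 1)), lt_min (by positivity) (by positivity), ?_, ?_⟩
  · have h := min_le_left (e₁ / (c₁ + 1)) (e₂ / (c₂ + 1))
    have : min (e₁ / (c₁ + 1)) (e₂ / (c₂ + 1)) * (c₁ + 1) ≤ e₁ := by
      rwa [← le_div_iff₀ (by positivity)]
    have h0 : 0 < min (e₁ / (c₁ + 1)) (e₂ / (c₂ + 1)) := lt_min (by positivity) (by positivity)
    nlinarith
  · have h := min_le_right (e₁ / (c₁ + 1)) (e₂ / (c₂ + 1))
    have : min (e₁ / (c₁ + 1)) (e₂ / (c₂ + 1)) * (c₂ + 1) ≤ e₂ := by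
      rwa [← le_div_iff₀ (by positivity)]
    have h0 : 0 < min (e₁ / (c₁ + 1)) (e₂ / (c₂ + 1)) := lt_min (by positivity) (by positivity)
    nlinarith

lemma main_meas {lam μ ν : ℝ} (hlam : 1 < lam) (hμ : 0 < μ) (hν : lam * (stripC * μ) < ν)
    {w : ℝ × ℝ → ℝ} (hwm : Measurable w) (hw : IsMaximizer lam μ ν w) :
    ∃ W : ℝ, 0 < W ∧ ∀ᵐ x ∂mU, w x = lam * max (Gop w x - W * x.2) 0 := by
  have hl0 : 0 < lam := by linarith
  have hw2 := adm_memLp hw.1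
  have hw1 : Integrable w mU := hw.1.2.1
  have hw0 := hw.1.1
  have hphi := ph_nonneg hl0 hwm hw
  have hmass : ∫ x in UHP, w x < ν := by
    obtain ⟨hg, hgm⟩ := gop_mass hw.1
    have : ∫ x in UHP, w x ≤ ∫ x in UHP, lam * Gop w x := by
      refine integral_mono_ae hw1 (hg.const_mul lam) ?_
      filter_upwards [hphi] with x hx
      rw [ph, one_div, inv_mul_eq_div, sub_nonneg, div_le_iff₀ hl0] at hx
      linarith
    rw [integral_const_mul] at this
    have h2 := mul_le_mul_of_nonneg_left hgm hl0.le
    linarith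
  -- the reference set
  obtain ⟨n, hn⟩ : ∃ n, mU (Pn w n) ≠ 0 := by
    by_contra hcon
    push Not at hcon
    have h0 : ∀ᵐ x ∂mU, ∀ n, x ∉ Pn w n := ae_all_iff.2 fun n => measure_eq_zero_iff_ae_notMem.1 (hcon n)
    have h1 : ∫ x in UHP, x.2 * w x = 0 := by
      rw [← integral_zero (ℝ × ℝ) ℝ (μ := mU)]
      refine integral_congr_ae ?_
      filter_upwards [h0, ae_restrict_mem uhp_meas] with x hx hxU
      have : w x = 0 := by
        by_contra hne
        obtain ⟨n, hn⟩ := exists_pn hxU (lt_of_le_of_ne (hw0 x hxU) (Ne.symm hne))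
        exact hx n hn
      simp [this]
    have h2 : ∫ x in UHP, x.2 * w x = μ := hw.1.2.2.2.2.1
    linarith
  set D := Pn w n with hDdef
  have hD : MeasurableSet D := pn_meas hwm n
  have hDn : D ⊆ Bx n := pn_sub w n
  set d := ∫ x in D, x.2 ∂mU with hd
  have hd0 : 0 < d := by
    rw [hd, setIntegral_pos_iff_support_of_nonneg_ae
      ((ae_restrict_iff' hD).2 (Eventually.of_forall fun x hx => (hDn hx).1.le)) (bx_snd_int hD hDn)]
    refine lt_of_lt_of_le (pos_iff_ne_zero.2 hn) (measure_mono fun x hx => ⟨?_, hx⟩)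
    exact (hDn hx).1.ne'
  set W := (∫ x in D, ph lam w x ∂mU) / d with hW
  have hWd : ∫ x in D, ph lam w x ∂mU = W * d := by rw [hW]; field_simp
  have hδ : 0 < 1 / ((n:ℝ) + 1) := by positivity
  have hDw : ∀ x ∈ D, 1 / ((n:ℝ) + 1) ≤ w x := fun x hx => hx.2
  have ind0 : ∀ (S : Set (ℝ × ℝ)) x, 0 ≤ S.indicator (fun _ => (1:ℝ)) x :=
    fun S x => Set.indicator_nonneg (fun _ _ => zero_le_one) _
  have hWint : ∀ {A : Set (ℝ × ℝ)} {k : ℕ}, MeasurableSet A → A ⊆ Bx k →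
      IntegrableOn (fun x : ℝ × ℝ => W * x.2) A mU := fun hA hk => (bx_snd_int hA hk).const_mul W
  -- upper inequality
  have hup : ∀ k, ∀ᵐ x ∂mU, x ∈ Bx k → 0 ≤ W * x.2 - ph lam w x := by
    intro k
    refine ae_set_nonneg (bx_meas k)
      ((hWint (bx_meas k) subset_rfl).sub (bx_ph_int hw2 hw1 (bx_meas k) subset_rfl)) ?_
    intro A hA hAk
    rw [integral_sub (hWint hA hAk) (bx_ph_int hw2 hw1 hA hAk), integral_const_mul]
    set α := ∫ x in A, x.2 ∂mU with hα
    have hα0 : 0 ≤ α := bx_snd_nonneg hA hAk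
    have hαd : 0 ≤ α / d := by positivity
    obtain ⟨s, hs, hs1, hs2⟩ := exists_small hδ (sub_pos.2 hmass) hαd
      (measureReal_nonneg (μ := mU) (s := A))
    have h := two_set hl0 hw hA hAk hD hDn 1 (-(α / d)) hs
      (by rw [← hα, ← hd]; field_simp; ring) (by
        intro x hx
        have h0 := hw0 x hx
        have hiA := ind0 A x
        by_cases hxD : x ∈ D
        · have h1 := hDw x hxD
          rw [Set.indicator_of_mem hxD]
          nlinarith
        · rw [Set.indicator_of_notMem hxD]
          nlinarith) (by
        have h1 : 0 ≤ mU.real D := measureReal_nonneg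
        have h2 : 0 ≤ s * (α / d * mU.real D) := by positivity
        nlinarith)
    rw [hWd] at h
    have e : -(α / d) * (W * d) = -(W * α) := by field_simp
    rw [e] at h
    linarith
  -- lower inequality
  have hlow : ∀ k, ∀ᵐ x ∂mU, x ∈ Pn w k → 0 ≤ ph lam w x - W * x.2 := by
    intro k
    have hPm := pn_meas hwm k
    refine ae_set_nonneg hPm
      ((bx_ph_int hw2 hw1 hPm (pn_sub w k)).sub (hWint hPm (pn_sub w k))) ?_
    intro A hA hAP
    have hAk := hAP.trans (pn_sub w k)
    rw [integral_sub (bx_ph_int hw2 hw1 hA hAk) (hWint hA hAk), integral_const_mul]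
    set α := ∫ x in A, x.2 ∂mU with hα
    have hα0 : 0 ≤ α := bx_snd_nonneg hA hAk
    have hαd : 0 ≤ α / d := by positivity
    have hk : 0 < 1 / ((k:ℝ) + 1) := by positivity
    have hDr : 0 ≤ mU.real D := measureReal_nonneg
    obtain ⟨s, hs, hs1, hs2⟩ := exists_small hk (sub_pos.2 hmass) zero_le_one
      (mul_nonneg hαd hDr)
    have h := two_set hl0 hw hA hAk hD hDn (-1) (α / d) hs
      (by rw [← hα, ← hd]; field_simp; ring) (by
        intro x hx
        have h0 := hw0 x hx
        have hiD := mul_nonneg hs.le (mul_nonneg hαd (ind0 D x))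
        by_cases hxA : x ∈ A
        · have h1 : 1 / ((k:ℝ) + 1) ≤ w x := (hAP hxA).2
          rw [Set.indicator_of_mem hxA]
          nlinarith
        · rw [Set.indicator_of_notMem hxA]
          nlinarith) (by
        have h1 : 0 ≤ mU.real A := measureReal_nonneg
        have h2 : 0 ≤ s * mU.real A := by positivity
        nlinarith)
    rw [hWd] at h
    have e : (α / d) * (W * d) = W * α := by field_simp
    rw [e] at h
    linarith
  have hW0 : 0 ≤ W := by
    refine div_nonneg ?_ hd0.le
    exact setIntegral_nonneg_of_ae_restrict (ae_restrict_of_ae hphi)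
  have hup' : ∀ᵐ x ∂mU, ph lam w x ≤ W * x.2 := by
    filter_upwards [ae_all_iff.2 hup, ae_restrict_mem uhp_meas] with x hx hxU
    obtain ⟨k, hk⟩ := exists_bx hxU
    linarith [hx k hk]
  have hWpos : 0 < W := by
    refine lt_of_le_of_ne hW0 fun h0 => ?_
    have h1 : ∫ x in UHP, x.2 * w x = ∫ x in UHP, lam * (x.2 * Gop w x) := by
      refine integral_congr_ae ?_
      filter_upwards [hup', hphi] with x h2 h3
      rw [← h0, zero_mul] at h2
      have h4 : ph lam w x = 0 := le_antisymm h2 h3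
      rw [ph, one_div, inv_mul_eq_div, sub_eq_zero, eq_div_iff hl0.ne'] at h4
      rw [← h4]
      ring
    rw [integral_const_mul, gop_impulse hw.1] at h1
    have h2 : ∫ x in UHP, x.2 * w x = μ := hw.1.2.2.2.2.1
    rw [h2] at h1
    nlinarith
  refine ⟨W, hWpos, ?_⟩
  filter_upwards [hup', ae_all_iff.2 hlow, ae_restrict_mem uhp_meas] with x h1 h2 hxU
  by_cases h : 0 < w x
  · obtain ⟨k, hk⟩ := exists_pn hxU h
    have h3 : ph lam w x = W * x.2 := le_antisymm h1 (by linarith [h2 k hk])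
    rw [ph] at h3
    have h4 : Gop w x - W * x.2 = 1 / lam * w x := by linarith
    rw [h4, max_eq_left (by positivity)]
    field_simp
  · have h0 : w x = 0 := le_antisymm (not_lt.1 h) (hw0 x hxU)
    rw [ph, h0, mul_zero, sub_zero] at h1
    rw [h0, max_eq_right (by linarith), mul_zero]

lemma gop_congr {w w' : ℝ × ℝ → ℝ} (h : w =ᵐ[mU] w') : Gop w = Gop w' := by
  ext x
  refine integral_congr_ae ?_
  filter_upwards [h] with y hy
  rw [hy]

lemma max_congr {lam μ ν : ℝ} {w w' : ℝ × ℝ → ℝ} (h : w =ᵐ[mU] w') (h0 : ∀ x ∈ UHP, 0 ≤ w' x)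
    (hw : IsMaximizer lam μ ν w) : IsMaximizer lam μ ν w' := by
  have hsq : (fun x => w x ^ 2) =ᵐ[mU] (fun x => w' x ^ 2) := by
    filter_upwards [h] with x hx
    rw [hx]
  have hsn : (fun x => x.2 * w x) =ᵐ[mU] (fun x => x.2 * w' x) := by
    filter_upwards [h] with x hx
    rw [hx]
  have hE : Efun lam w' = Efun lam w := by
    rw [Efun, Efun, kineticE, kineticE, ← gop_congr h, integral_congr_ae hsq]
    congr 2
    refine integral_congr_ae ?_
    filter_upwards [h] with x hx
    rw [hx]
  obtain ⟨⟨_, a2, a3, a4, a5, a6⟩, b⟩ := hw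
  refine ⟨⟨h0, Integrable.congr a2 h, Integrable.congr a3 hsq, Integrable.congr a4 hsn, ?_, ?_⟩,
    hE.trans b⟩
  · rw [← a5]
    exact (integral_congr_ae hsn).symm
  · rw [← integral_congr_ae h]
    exact a6

/-- for `ν` large, the Lagrange multipliers satisfy `W > 0` and `γ = 0`. -/
theorem stmt9 (lam μ : ℝ) (hlam : 1 < lam) (hμ : 0 < μ) :
    ∃ ν₀ : ℝ, μ * varrho lam < ν₀ ∧ ∀ ν : ℝ, ν₀ ≤ ν →
      ∀ ω : ℝ × ℝ → ℝ, IsMaximizer lam μ ν ω →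
        ∃ W : ℝ, 0 < W ∧
          ∀ᵐ x ∂(volume.restrict UHP), ω x = lam * max (Gop ω x - W * x.2) 0 := by
  refine ⟨max (μ * varrho lam) (lam * (stripC * μ)) + 1, ?_, ?_⟩
  · linarith [le_max_left (μ * varrho lam) (lam * (stripC * μ))]
  · intro ν hν ω hω
    have hν' : lam * (stripC * μ) < ν := by
      linarith [le_max_right (μ * varrho lam) (lam * (stripC * μ))]
    have hm : AEMeasurable ω mU := hω.1.2.1.1.aemeasurable
    let w : ℝ × ℝ → ℝ := fun x => max (hm.mk ω x) 0
    have hwm : Measurable w := hm.measurable_mk.max measurable_const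
    have hae : ω =ᵐ[mU] w := by
      filter_upwards [hm.ae_eq_mk, ae_restrict_mem uhp_meas] with x hx hxU
      simp only [w]
      rw [← hx, max_eq_left (hω.1.1 x hxU)]
    obtain ⟨W, hW, h⟩ := main_meas hlam hμ hν' hwm
      (max_congr hae (fun x _ => le_max_right _ _) hω)
    refine ⟨W, hW, ?_⟩
    filter_upwards [h, hae] with x h1 h2
    rw [h2, h1, gop_congr hae]
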